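/- Let G be a simple graph and let V_s and V_t be vertex covers of G, each a set of size k. There exists a relaxed token jumping sequence from V_s to V_t if and only if there exists a Token Jumping reconfiguration sequence from V_s to V_t, i.e., a sequence of vertex covers of G of size k (with no two tokens on the same vertex) starting at V_s and ending at V_t in which consecutive configurations differ by moving a single token from one vertex to an arbitrary unoccupied vertex. -/

import Mathlib

/-- A vertex cover of a simple graph: every edge has an endpoint in the set. -/
def IsVC {V : Type*} (G : SimpleGraph V) (S : Finset V) : Prop :=
  ∀ ⦃u v : V⦄, G.Adj u v → u ∈ S ∨ v ∈ S

/-- A relaxed token jumping move (with token budget `k`) from the multiset `C` of tokens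
to the multiset `C'`: simultaneously remove a multiset `R` of tokens, add a multiset `A`
of tokens (possibly onto occupied vertices), and perform the jumps listed in `J`
(each jump moves one existing token from its vertex to an arbitrary, possibly occupied,
vertex), subject to `|A| ≤ k - |C|` and `|A| + |J| ≤ k - |C| + 1`. -/
def RelaxedMove {V : Type*} [DecidableEq V] (k : ℕ) (C C' : Multiset V) : Prop :=
  ∃ (R A : Multiset V) (J : Multiset (V × V)),
    R + J.map Prod.fst ≤ C ∧
    C' = (C - (R + J.map Prod.fst)) + A + J.map Prod.snd ∧
    A.card ≤ k - C.card ∧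
    A.card + J.card ≤ k - C.card + 1

/-- One Token Jumping step between vertex covers of size `k`. -/
def TokenJump {V : Type*} [DecidableEq V] (G : SimpleGraph V) (k : ℕ) (S S' : Finset V) : Prop :=
  IsVC G S' ∧ S'.card = k ∧ ∃ u ∈ S, ∃ v : V, v ∉ S ∧ S' = insert v (S.erase u)

section TokenJump

variable {V : Type*} {G : SimpleGraph V} {k : ℕ}

theorem IsVC.mono {S T : Finset V} (hS : IsVC G S) (h : S ⊆ T) : IsVC G T :=
  fun _ _ huv => (hS huv).imp (fun hu => h hu) (fun hv => h hv)

variable [DecidableEq V]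

/-- A chain of Token Jumping steps can be listed as a sequence. -/
theorem exists_seq_of_reflTransGen_tokenJump {S T : Finset V} (hS : IsVC G S) (hk : S.card = k)
    (h : Relation.ReflTransGen (TokenJump G k) S T) :
    ∃ (p : ℕ) (F : ℕ → Finset V), F 0 = S ∧ F p = T ∧
      (∀ i ≤ p, IsVC G (F i) ∧ (F i).card = k) ∧
      (∀ i < p, ∃ u ∈ F i, ∃ v : V, v ∉ F i ∧ F (i + 1) = insert v ((F i).erase u)) := by
  induction h with
  | refl => exact ⟨0, fun _ => S, rfl, rfl, fun _ _ => ⟨hS, hk⟩, fun i hi => by omega⟩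
  | @tail T T' _ hstep ih =>
    obtain ⟨p, F, h0, hp, hcover, hjump⟩ := ih
    obtain ⟨hT', hk', hmove⟩ := hstep
    refine ⟨p + 1, fun i => if i ≤ p then F i else T', by simpa using h0, by simp, ?_, ?_⟩
    · intro i _
      by_cases hi : i ≤ p
      · simpa [hi] using hcover i hi
      · simpa [hi] using ⟨hT', hk'⟩
    · intro i hi
      rcases (Nat.lt_succ_iff_lt_or_eq.mp hi) with hlt | rfl
      · have hle : i ≤ p := hlt.le
        have hle' : i + 1 ≤ p := hlt
        simpa only [hle, hle', if_true] using hjump i hlt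
      · simpa [hp] using hmove

/-- Two covers of size `k` containing a common cover are connected by token jumps. -/
theorem reflTransGen_tokenJump_of_common_subset {S T T' : Finset V} (hS : IsVC G S)
    (hT : S ⊆ T) (hT' : S ⊆ T') (hk : T.card = k) (hk' : T'.card = k) :
    Relation.ReflTransGen (TokenJump G k) T T' := by
  induction hn : (T \ T').card generalizing T with
  | zero =>
    have hsub : T ⊆ T' := Finset.sdiff_eq_empty_iff_subset.mp (Finset.card_eq_zero.mp hn)
    rw [Finset.eq_of_subset_of_card_le hsub (by omega)]
  | succ n ih =>
    obtain ⟨u, hu⟩ : (T \ T').Nonempty := Finset.card_pos.mp (by omega)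
    obtain ⟨v, hv⟩ : (T' \ T).Nonempty := by
      rw [← Finset.card_pos, ← Finset.card_sdiff_comm (hk.trans hk'.symm)]
      omega
    rw [Finset.mem_sdiff] at hu hv
    have hsub : S ⊆ insert v (T.erase u) := fun x hx =>
      Finset.mem_insert_of_mem
        (Finset.mem_erase.mpr ⟨fun h => hu.2 (h ▸ hT' hx), hT hx⟩)
    have hcard : (insert v (T.erase u)).card = k := by
      rw [Finset.card_insert_of_notMem (fun h => hv.2 (Finset.mem_of_mem_erase h)),
        Finset.card_erase_add_one hu.1, hk]
    refine Relation.ReflTransGen.head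
      ⟨hS.mono hsub, hcard, u, hu.1, v, hv.2, rfl⟩ (ih hsub hcard ?_)
    have hdiff : insert v (T.erase u) \ T' = (T \ T').erase u := by
      ext x
      simp only [Finset.mem_sdiff, Finset.mem_insert, Finset.mem_erase]
      have hne : x = v → x ∈ T' := fun h => h ▸ hv.1
      tauto
    rw [hdiff, Finset.card_erase_of_mem (Finset.mem_sdiff.mpr hu), hn, Nat.add_sub_cancel]

/-- If two covers of size at most `k` have a union of size at most `k + 1`, then every cover of
size `k` containing the second is reachable from some cover of size `k` containing the first. -/
theorem exists_reflTransGen_tokenJump_of_card_union_le {S S' T' : Finset V}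
    (hS' : IsVC G S') (hk : S.card ≤ k) (hU : (S ∪ S').card ≤ k + 1)
    (hT' : S' ⊆ T') (hk' : T'.card = k) :
    ∃ T, S ⊆ T ∧ T.card = k ∧ Relation.ReflTransGen (TokenJump G k) T T' := by
  rcases Nat.lt_or_ge k (S ∪ S').card with hlt | hle
  · have hcardS' : S'.card ≤ k := hk' ▸ Finset.card_le_card hT'
    have key : ∀ A ⊆ S ∪ S', A.card ≤ k → ∃ u ∈ S ∪ S', u ∉ A ∧
        A ⊆ (S ∪ S').erase u ∧ ((S ∪ S').erase u).card = k := by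
      intro A hA hAk
      obtain ⟨u, hu, huA⟩ := Finset.exists_mem_notMem_of_card_lt_card (hAk.trans_lt hlt)
      refine ⟨u, hu, huA, fun x hx => Finset.mem_erase.mpr ⟨fun h => huA (h ▸ hx), hA hx⟩, ?_⟩
      rw [Finset.card_erase_of_mem hu]
      omega
    obtain ⟨u, hu, huS, hsub, hcard⟩ := key S Finset.subset_union_left hk
    obtain ⟨u', hu', huS', hsub', hcard'⟩ := key S' Finset.subset_union_right hcardS'
    refine ⟨_, hsub, hcard, .trans ?_
      (reflTransGen_tokenJump_of_common_subset hS' hsub' hT' hcard' hk')⟩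
    by_cases huu : u = u'
    · rw [huu]
    · refine .single ⟨hS'.mono hsub', hcard', u',
        Finset.mem_erase.mpr ⟨Ne.symm huu, hu'⟩, u, Finset.notMem_erase _ _, ?_⟩
      rw [Finset.erase_right_comm, Finset.insert_erase (Finset.mem_erase.mpr ⟨huu, hu⟩)]
  · obtain ⟨T, hUT, -, hTk⟩ := Finset.exists_subsuperset_card_eq
      (Finset.subset_union_left (s₁ := S ∪ S') (s₂ := T')) hle
      (hk' ▸ Finset.card_le_card Finset.subset_union_right)
    exact ⟨T, Finset.subset_union_left.trans hUT, hTk,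
      reflTransGen_tokenJump_of_common_subset hS' (Finset.subset_union_right.trans hUT)
        hT' hTk hk'⟩

/-- The supports before and after a relaxed move occupy at most `k + 1` vertices in total. -/
theorem RelaxedMove.card_union_le {C C' : Multiset V} (h : RelaxedMove k C C')
    (hC : C.card ≤ k) : (C.toFinset ∪ C'.toFinset).card ≤ k + 1 := by
  obtain ⟨R, A, J, -, rfl, -, hAJ⟩ := h
  have hsub : C.toFinset ∪ (C - (R + J.map Prod.fst) + A + J.map Prod.snd).toFinset ⊆
      (C + A + J.map Prod.snd).toFinset := by
    intro x hx
    simp only [Finset.mem_union, Multiset.mem_toFinset, Multiset.mem_add] at hx ⊢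
    rcases hx with hx | (hx | hx) | hx
    · exact .inl (.inl hx)
    · exact .inl (.inl (Multiset.mem_of_le (Multiset.sub_le_self _ _) hx))
    · exact .inl (.inr hx)
    · exact .inr hx
  have hcard := (Finset.card_le_card hsub).trans (Multiset.toFinset_card_le _)
  simp only [Multiset.card_add, Multiset.card_map] at hcard
  omega

/-- A token jump is a relaxed move. -/
theorem relaxedMove_insert_erase {S : Finset V} {u v : V} (hu : u ∈ S) (hv : v ∉ S) :
    RelaxedMove k S.val (insert v (S.erase u)).val := by
  refine ⟨0, 0, {(u, v)}, by simpa using hu, ?_, by simp, by simp⟩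
  rw [Finset.insert_val_of_notMem (fun h => hv (Finset.mem_of_mem_erase h)), Finset.erase_val]
  simpa using Multiset.add_comm {v} (S.val.erase u)

end TokenJump

theorem statement_18 {V : Type*} [DecidableEq V] (G : SimpleGraph V) (k : ℕ)
    (Vs Vt : Finset V) (hVs : IsVC G Vs) (hVt : IsVC G Vt)
    (hs : Vs.card = k) (ht : Vt.card = k) :
    -- a relaxed token jumping sequence from `Vs` to `Vt`
    (∃ (p : ℕ) (C : ℕ → Multiset V),
        C 0 = Vs.val ∧ C p = Vt.val ∧
        (∀ i ≤ p, IsVC G (C i).toFinset ∧ (C i).card ≤ k) ∧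
        (∀ i < p, RelaxedMove k (C i) (C (i + 1)))) ↔
    -- a Token Jumping sequence from `Vs` to `Vt`:
    -- vertex covers of size `k`, consecutive ones differing by moving a single
    -- token to an arbitrary unoccupied vertex
    (∃ (p : ℕ) (S : ℕ → Finset V),
        S 0 = Vs ∧ S p = Vt ∧
        (∀ i ≤ p, IsVC G (S i) ∧ (S i).card = k) ∧
        (∀ i < p, ∃ u ∈ S i, ∃ v : V, v ∉ S i ∧
          S (i + 1) = insert v ((S i).erase u))) := by
  constructor
  · rintro ⟨p, C, h0, hp, hC, hmove⟩
    have reach : ∀ i ≤ p, ∀ T : Finset V, (C i).toFinset ⊆ T → T.card = k →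
        Relation.ReflTransGen (TokenJump G k) Vs T := by
      intro i
      induction i with
      | zero =>
        intro _ T hT hTk
        rw [h0, Finset.val_toFinset] at hT
        exact reflTransGen_tokenJump_of_common_subset hVs subset_rfl hT hs hTk
      | succ i ih =>
        intro hi T' hT' hk'
        have hCi := (hC i (by omega)).2
        obtain ⟨T, hT, hTk, hTT'⟩ := exists_reflTransGen_tokenJump_of_card_union_le
          (hC (i + 1) hi).1 ((Multiset.toFinset_card_le _).trans hCi)
          ((hmove i hi).card_union_le hCi) hT' hk'
        exact (ih (by omega) T hT hTk).trans hTT'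
    exact exists_seq_of_reflTransGen_tokenJump hVs hs
      (reach p le_rfl Vt (by rw [hp, Finset.val_toFinset]) ht)
  · rintro ⟨p, S, h0, hp, hS, hmove⟩
    refine ⟨p, fun i => (S i).val,
      congrArg Finset.val h0, congrArg Finset.val hp, fun i hi => ?_, fun i hi => ?_⟩
    · exact ⟨by simpa only [Finset.val_toFinset] using (hS i hi).1, (hS i hi).2.le⟩
    · obtain ⟨u, hu, v, hv, hSi⟩ := hmove i hi
      simpa only [hSi] using relaxedMove_insert_erase hu hv
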